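/- arXiv:1902.06503 — 2 statements merged into one kernel-verified Lean document; each statement's English description precedes it below -/
import Mathlib

section
/- Let n > 2m with m ≥ 1 and let L be a uniformly elliptic constant-coefficient operator of order 2m on ℝⁿ. If K and K̃ are both locally integrable on ℝⁿ, continuous on ℝⁿ\{0}, homogeneous of degree 2m−n, and fundamental solutions of L, then K(x) = K̃(x) for every x ∈ ℝⁿ\{0}. -/
open MeasureTheory RealInnerProductSpace

noncomputable section

/-- ℝⁿ as a Euclidean space. -/
abbrev En (n : ℕ) : Type := EuclideanSpace ℝ (Fin n)

/-- The `i`-th standard basis vector of ℝⁿ. -/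
def stdB (n : ℕ) (i : Fin n) : En n := EuclideanSpace.single i 1

/-- The symbol Q(ξ) = Σ_{i₁,…,i_{2m}} A_{i₁…i_{2m}} ξ_{i₁}⋯ξ_{i_{2m}}. -/
def symbolQ (n m : ℕ) (A : (Fin (2*m) → Fin n) → ℝ) (ξ : En n) : ℝ :=
  ∑ i : Fin (2*m) → Fin n, A i * ∏ j, ξ (i j)

/-- The constant-coefficient operator
(Lψ)(x) = (−1)^m Σ A_{i₁…i_{2m}} ∂_{i₁}⋯∂_{i_{2m}} ψ(x). -/
def opL (n m : ℕ) (A : (Fin (2*m) → Fin n) → ℝ) (ψ : En n → ℝ) (x : En n) : ℝ :=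
  (-1 : ℝ)^m * ∑ i : Fin (2*m) → Fin n,
    A i * iteratedFDeriv ℝ (2*m) ψ x (fun j => stdB n (i j))

/-- K is a fundamental solution of L: ∫ K(y) (Lψ)(y) dy = ψ(0) for all ψ ∈ C_c^∞. -/
def IsFundamentalSolution (n m : ℕ) (A : (Fin (2*m) → Fin n) → ℝ) (K : En n → ℝ) : Prop :=
  ∀ ψ : En n → ℝ, ContDiff ℝ (⊤ : ℕ∞) ψ → HasCompactSupport ψ →
    ∫ y, K y * opL n m A ψ y = ψ 0

/-- K is homogeneous of degree a: K(σx) = |σ|^a K(x) for σ ≠ 0, x ≠ 0. -/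
def HomogeneousDeg (n : ℕ) (a : ℝ) (K : En n → ℝ) : Prop :=
  ∀ σ : ℝ, σ ≠ 0 → ∀ x : En n, x ≠ 0 → K (σ • x) = |σ| ^ a * K x

/-- The Euclidean Laplacian Δf(x) = Σ_i ∂²f/∂x_i²(x). -/
def lap (n : ℕ) (f : En n → ℝ) (x : En n) : ℝ :=
  ∑ i : Fin n, iteratedFDeriv ℝ 2 f x (fun _ => stdB n i)

/-- The point (x′, t) ∈ ℝ^{d} × ℝ = ℝ^{d+1}. -/
def snocVec (d : ℕ) (x' : En d) (t : ℝ) : En (d+1) :=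
  (EuclideanSpace.equiv (Fin (d+1)) ℝ).symm (Fin.snoc (fun i => x' i) t)

open FourierTransform ContDiff Filter Topology Convolution

lemma natle (k : ℕ) : (k : ℕ∞ω) ≤ ∞ := by exact_mod_cast le_top

/-- bound for pairing -/
lemma aux_bound {n : ℕ} {u : En n → ℝ} (hu : LocallyIntegrable u volume)
    (hdec : Tendsto u (cocompact (En n)) (𝓝 0)) {δ : ℝ} (hδ : 0 < δ) :
    ∃ W : En n → ℝ, Integrable W volume ∧ (∀ x, 0 ≤ W x) ∧ ∀ x, |u x| ≤ W x + δ := by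
  have h1 : ∀ᶠ x in cocompact (En n), |u x| < δ := by
    have := hdec.abs
    rw [abs_zero] at this
    exact this.eventually (gt_mem_nhds hδ)
  obtain ⟨t, ht, hts⟩ := mem_cocompact.1 h1
  refine ⟨t.indicator fun x => |u x|, ?_, ?_, ?_⟩
  · exact (integrable_indicator_iff ht.measurableSet).2 ((hu.integrableOn_isCompact ht).abs)
  · intro x; exact Set.indicator_nonneg (fun _ _ => abs_nonneg _) x
  · intro x
    by_cases hx : x ∈ t
    · simp [hx, hδ.le]
    · simp only [Set.indicator_of_notMem hx, zero_add]
      exact (hts hx : |u x| < δ).le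

lemma aux_integrable {n : ℕ} {u : En n → ℝ} (hu : LocallyIntegrable u volume)
    (hdec : Tendsto u (cocompact (En n)) (𝓝 0)) {F : Type*} [NormedAddCommGroup F]
    [NormedSpace ℝ F] {g : En n → F}
    (hg : Integrable g volume) {B : ℝ} (hB : ∀ x, ‖g x‖ ≤ B) :
    Integrable (fun x => u x • g x) volume := by
  obtain ⟨W, hW, hW0, hWu⟩ := aux_bound hu hdec one_pos
  refine Integrable.mono' ((hW.mul_const B).add hg.norm)
    (hu.aestronglyMeasurable.smul hg.aestronglyMeasurable) (ae_of_all _ fun x => ?_)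
  rw [norm_smul, Real.norm_eq_abs, Pi.add_apply]
  have h1 := hWu x
  have h2 := hB x
  have h3 := hW0 x
  have := norm_nonneg (g x)
  nlinarith

lemma aux_quant {n : ℕ} {u : En n → ℝ} (hu : LocallyIntegrable u volume)
    (hdec : Tendsto u (cocompact (En n)) (𝓝 0)) {δ : ℝ} (hδ : 0 < δ) :
    ∃ C : ℝ, ∀ (g : En n → ℂ) (B : ℝ), Integrable g volume → (∀ x, ‖g x‖ ≤ B) →
      ‖∫ x, u x • g x‖ ≤ C * B + δ * ∫ x, ‖g x‖ := by
  obtain ⟨W, hW, hW0, hWu⟩ := aux_bound hu hdec hδ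
  refine ⟨∫ x, W x, fun g B hg hB => ?_⟩
  rw [← integral_mul_const, ← integral_const_mul, ← integral_add (hW.mul_const B)
    (hg.norm.const_mul δ)]
  refine norm_integral_le_of_norm_le ((hW.mul_const B).add (hg.norm.const_mul δ))
    (ae_of_all _ fun x => ?_)
  rw [norm_smul, Real.norm_eq_abs]
  have h1 := hWu x
  have h2 := hB x
  have h3 := hW0 x
  have := norm_nonneg (g x)
  nlinarith

lemma opL_continuous {n m : ℕ} (A : (Fin (2*m) → Fin n) → ℝ) {f : En n → ℝ}
    (hf : ContDiff ℝ ∞ f) : Continuous (opL n m A f) := by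
  unfold opL
  have : Continuous (iteratedFDeriv ℝ (2*m) f) :=
    hf.continuous_iteratedFDeriv (natle _)
  refine continuous_const.mul (continuous_finsetSum _ fun i _ => continuous_const.mul ?_)
  exact (ContinuousMultilinearMap.apply ℝ (fun _ => En n) ℝ _).continuous.comp this

lemma opL_bound {n m : ℕ} (A : (Fin (2*m) → Fin n) → ℝ) (f : En n → ℝ) (x : En n) :
    |opL n m A f x| ≤ (∑ i, |A i|) * ‖iteratedFDeriv ℝ (2*m) f x‖ := by
  unfold opL
  rw [abs_mul, abs_pow, abs_neg, abs_one, one_pow, one_mul, Finset.sum_mul]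
  refine (Finset.abs_sum_le_sum_abs _ _).trans (Finset.sum_le_sum fun i _ => ?_)
  rw [abs_mul]
  refine mul_le_mul_of_nonneg_left ?_ (abs_nonneg _)
  refine (ContinuousMultilinearMap.le_opNorm (iteratedFDeriv ℝ (2*m) f x) _).trans ?_
  simp [stdB]

lemma opL_compact {n m : ℕ} (A : (Fin (2*m) → Fin n) → ℝ) {f : En n → ℝ}
    (hf : HasCompactSupport f) : HasCompactSupport (opL n m A f) := by
  refine (hf.iteratedFDeriv (𝕜 := ℝ) (2*m)).mono ?_
  intro x hx
  contrapose! hx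
  have : iteratedFDeriv ℝ (2*m) f x = 0 := by simpa using hx
  simp [opL, this]

lemma aux_cutoff {n : ℕ} : ∃ χ : En n → ℝ, ContDiff ℝ ∞ χ ∧ HasCompactSupport χ ∧
    (∀ x, ‖x‖ ≤ 1 → χ x = 1) ∧ (∀ x, 0 ≤ χ x) ∧ ∀ x, χ x ≤ 1 := by
  let b : ContDiffBump (0 : En n) := ⟨1, 2, one_pos, one_lt_two⟩
  exact ⟨b, b.contDiff, b.hasCompactSupport,
    fun x hx => b.one_of_mem_closedBall (by simpa using hx), fun x => b.nonneg, fun x => b.le_one⟩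

lemma aux_ext {n m : ℕ} (A : (Fin (2*m) → Fin n) → ℝ)
    {u : En n → ℝ} (hu : LocallyIntegrable u volume)
    (hdec : Tendsto u (cocompact (En n)) (𝓝 0))
    (hz : ∀ ψ : En n → ℝ, ContDiff ℝ ∞ ψ → HasCompactSupport ψ → ∫ y, u y * opL n m A ψ y = 0)
    {f : En n → ℝ} (hf : ContDiff ℝ ∞ f) {G : En n → ℝ} (hG : Integrable G volume) {B : ℝ}
    (hGB : ∀ x, G x ≤ B)
    (hfG : ∀ k ≤ 2*m, ∀ x, ‖iteratedFDeriv ℝ k f x‖ ≤ G x) :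
    ∫ y, u y * opL n m A f y = 0 := by
  obtain ⟨χ, hχ, hχc, hχ1, -, -⟩ := aux_cutoff (n := n)
  have hD : ∃ D : ℝ, 0 ≤ D ∧ ∀ k ≤ 2*m, ∀ x, ‖iteratedFDeriv ℝ k χ x‖ ≤ D := by
    have : ∀ k, ∃ C, ∀ x, ‖iteratedFDeriv ℝ k χ x‖ ≤ C := fun k =>
      ((hχc.iteratedFDeriv (𝕜 := ℝ) k).exists_bound_of_continuous
        (hχ.continuous_iteratedFDeriv (natle _)))
    choose C hC using this
    refine ⟨∑ k ∈ Finset.range (2*m+1), |C k|, by positivity, fun k hk x => ?_⟩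
    refine ((hC k x).trans (le_abs_self _)).trans ?_
    exact Finset.single_le_sum (f := fun k => |C k|) (fun i _ => abs_nonneg _)
      (Finset.mem_range.2 (by omega))
  obtain ⟨D, hD0, hD⟩ := hD
  have hG0 : ∀ x, 0 ≤ G x := fun x => (norm_nonneg _).trans (hfG 0 (Nat.zero_le _) x)
  let s : ℕ → ℝ := fun N => 1 / ((N : ℝ) + 1)
  have hs0 : ∀ N, 0 < s N := fun N => by positivity
  have hs1 : ∀ N, s N ≤ 1 := fun N => by
    simp only [s]; rw [div_le_one (by positivity)]; linarith [(Nat.cast_nonneg N : (0:ℝ) ≤ N)]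
  let χN : ℕ → En n → ℝ := fun N x => χ (s N • x)
  have hχN : ∀ N, ContDiff ℝ ∞ (χN N) := fun N => hχ.comp (contDiff_const_smul _)
  have hχNc : ∀ N, HasCompactSupport (χN N) := fun N =>
    hχc.comp_homeomorph (Homeomorph.smulOfNeZero (s N) (hs0 N).ne')
  have hχND : ∀ N, ∀ k ≤ 2*m, ∀ x, ‖iteratedFDeriv ℝ k (χN N) x‖ ≤ D := by
    intro N k hk x
    have := iteratedFDeriv_comp_const_smul (i := k) (f := χ) (s N)
      (hχ.of_le (natle _))
    simp only [χN]
    rw [this, norm_smul, norm_pow, Real.norm_of_nonneg (hs0 N).le]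
    calc _ ≤ 1 * D := by
          gcongr
          · exact pow_le_one₀ (hs0 N).le (hs1 N)
          · exact hD k hk _
      _ = D := one_mul _
  let P : ℕ → En n → ℝ := fun N x => f x * χN N x
  have hP : ∀ N, ContDiff ℝ ∞ (P N) := fun N => hf.mul (hχN N)
  let E : ℝ := ∑ i ∈ Finset.range (2*m+1), ((2*m).choose i : ℝ) * D
  have hPb : ∀ N x, ‖iteratedFDeriv ℝ (2*m) (P N) x‖ ≤ E * G x := by
    intro N x
    refine (norm_iteratedFDeriv_mul_le (hf.of_le (natle (2*m)))
      ((hχN N).of_le (natle _)) x le_rfl).trans ?_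
    simp only [E]
    rw [Finset.sum_mul]
    refine Finset.sum_le_sum fun i hi => ?_
    have hi' : i ≤ 2*m := by have := Finset.mem_range.1 hi; omega
    calc _ ≤ ((2*m).choose i : ℝ) * G x * D := by
          have := hfG i hi' x
          have := hχND N (2*m-i) (by omega) x
          have := hG0 x
          gcongr
      _ = _ := by ring
  let S : ℝ := ∑ i, |A i|
  have hS : 0 ≤ S := by positivity
  have hint : Integrable (fun x => u x • (S * E * G x)) volume := by
    refine aux_integrable hu hdec (hG.const_mul (S * E)) (B := |S * E| * B) fun x => ?_
    rw [norm_mul, Real.norm_eq_abs, Real.norm_of_nonneg (hG0 x)]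
    exact mul_le_mul_of_nonneg_left (hGB x) (abs_nonneg _)
  have hlim : Tendsto (fun N => ∫ y, u y * opL n m A (P N) y) atTop
      (𝓝 (∫ y, u y * opL n m A f y)) := by
    refine tendsto_integral_of_dominated_convergence _ (fun N => ?_) hint.norm (fun N => ?_) ?_
    · exact hu.aestronglyMeasurable.mul (opL_continuous A (hP N)).aestronglyMeasurable
    · refine ae_of_all _ fun x => ?_
      rw [norm_mul, norm_smul]
      refine mul_le_mul_of_nonneg_left ?_ (norm_nonneg _)
      refine (opL_bound A (P N) x).trans ?_
      refine le_trans ?_ (le_abs_self _)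
      rw [mul_assoc]
      exact mul_le_mul_of_nonneg_left (hPb N x) hS
    · refine ae_of_all _ fun x => ?_
      refine tendsto_const_nhds.congr' ?_
      obtain ⟨N0, hN0⟩ := exists_nat_gt ‖x‖
      filter_upwards [eventually_ge_atTop N0] with N hN
      have hev : P N =ᶠ[𝓝 x] f := by
        have : ∀ᶠ y in 𝓝 x, ‖y‖ < N0 := (continuous_norm.tendsto x).eventually (gt_mem_nhds hN0)
        filter_upwards [this] with y hy
        have : χN N y = 1 := by
          apply hχ1
          rw [norm_smul, Real.norm_of_nonneg (hs0 N).le]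
          simp only [s]
          rw [div_mul_eq_mul_div, one_mul, div_le_one (by positivity)]
          have : (N0 : ℝ) ≤ N := by exact_mod_cast hN
          linarith
        simp [P, this]
      have h2 : iteratedFDeriv ℝ (2*m) (P N) x = iteratedFDeriv ℝ (2*m) f x :=
        (hev.iteratedFDeriv ℝ (2*m)).eq_of_nhds
      simp [opL, h2]
  have h0 : ∀ N, ∫ y, u y * opL n m A (P N) y = 0 := fun N =>
    hz _ (hP N) ((hχNc N).mul_left)
  simp only [h0] at hlim
  exact (tendsto_nhds_unique hlim tendsto_const_nhds)

lemma aux_symbol {n m : ℕ} (A : (Fin (2*m) → Fin n) → ℝ) (c : SchwartzMap (En n) ℂ) (x : En n) :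
    ∑ i, (A i : ℂ) * iteratedFDeriv ℝ (2*m) (𝓕 (c : En n → ℂ)) x (fun j => stdB n (i j)) =
      (-(2 * Real.pi * Complex.I)) ^ (2*m) *
        𝓕 (fun ξ => (symbolQ n m A ξ : ℂ) * c ξ) x := by
  have hpow : ∀ k : ℕ, (k : ℕ∞) ≤ ⊤ → Integrable (fun v => ‖v‖ ^ k * ‖c v‖) volume :=
    fun k _ => c.integrable_pow_mul volume k
  have hI : Integrable (fun v => VectorFourier.fourierPowSMulRight (innerSL ℝ) (c : En n → ℂ) v (2*m))
      volume :=
    VectorFourier.integrable_fourierPowSMulRight (innerSL ℝ) (hpow (2*m) le_top)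
      c.continuous.aestronglyMeasurable
  let Φ : En n → ContinuousMultilinearMap ℝ (fun _ : Fin (2*m) => En n) ℂ :=
    fun v => VectorFourier.fourierPowSMulRight (innerSL ℝ) (c : En n → ℂ) v (2*m)
  have hIΦ : Integrable Φ volume := hI
  have hΦ : ∀ v (i : Fin (2*m) → Fin n), Φ v (fun j => stdB n (i j)) =
      (-(2 * Real.pi * Complex.I)) ^ (2*m) * ((∏ j, v (i j) : ℝ) * c v) := by
    intro v i
    have h1 : Φ v (fun j => stdB n (i j)) = (-(2 * Real.pi * Complex.I)) ^ (2*m) •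
        (∏ j, innerSL ℝ v (stdB n (i j))) • c v :=
      VectorFourier.fourierPowSMulRight_apply (innerSL ℝ)
    rw [h1]
    have h2 : ∀ j, innerSL ℝ v (stdB n (i j)) = v (i j) := by
      intro j
      change inner ℝ v (stdB n (i j)) = v (i j)
      simp [stdB, EuclideanSpace.inner_single_right]
    simp_rw [h2, smul_eq_mul, Complex.real_smul]
  have hD : iteratedFDeriv ℝ (2*m) (𝓕 (c : En n → ℂ)) = 𝓕 Φ :=
    Real.iteratedFDeriv_fourier (N := ⊤) hpow c.continuous.aestronglyMeasurable le_top
  rw [hD]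
  have hterm : ∀ i : Fin (2*m) → Fin n, 𝓕 Φ x (fun j => stdB n (i j)) =
      ∫ v, Real.fourierChar (-inner ℝ v x) • ((-(2 * Real.pi * Complex.I)) ^ (2*m) *
        ((∏ j, v (i j) : ℝ) * c v)) := by
    intro i
    rw [Real.fourier_continuousMultilinearMap_apply hIΦ, Real.fourier_eq]
    simp_rw [hΦ]
  have hint : ∀ i : Fin (2*m) → Fin n, Integrable (fun v => Real.fourierChar (-inner ℝ v x) •
      ((-(2 * Real.pi * Complex.I)) ^ (2*m) * ((∏ j, v (i j) : ℝ) * c v))) volume := by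
    intro i
    rw [Real.fourierIntegral_convergent_iff]
    have := (ContinuousMultilinearMap.apply ℝ (fun _ => En n) ℂ
      (fun j => stdB n (i j))).integrable_comp hIΦ
    exact this.congr (ae_of_all _ fun v => hΦ v i)
  simp_rw [hterm, ← integral_const_mul]
  rw [← integral_finsetSum _ (fun i _ => (hint i).const_mul _), Real.fourier_eq,
    ← integral_const_mul]
  congr 1 with v
  simp only [symbolQ, Circle.smul_def, smul_eq_mul]
  push_cast
  rw [Finset.sum_mul, Finset.mul_sum, Finset.mul_sum]
  refine Finset.sum_congr rfl fun i _ => ?_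
  ring

lemma aux_four {n m : ℕ} (A : (Fin (2*m) → Fin n) → ℝ)
    {u : En n → ℝ} (hu : LocallyIntegrable u volume)
    (hdec : Tendsto u (cocompact (En n)) (𝓝 0))
    (hz : ∀ ψ : En n → ℝ, ContDiff ℝ ∞ ψ → HasCompactSupport ψ → ∫ y, u y * opL n m A ψ y = 0)
    (c : SchwartzMap (En n) ℂ) :
    ∫ x, u x • 𝓕 (fun ξ => (symbolQ n m A ξ : ℂ) * c ξ) x = 0 := by
  let h : En n → ℂ := 𝓕 (fun ξ => (symbolQ n m A ξ : ℂ) * c ξ)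
  change ∫ x, u x • h x = 0
  let g : SchwartzMap (En n) ℂ := 𝓕 c
  have hg : (g : En n → ℂ) = 𝓕 (c : En n → ℂ) := SchwartzMap.fourier_coe c
  let d : ℕ := Module.finrank ℝ (En n) + 1
  have hGi : Integrable (fun x : En n => (1 + ‖x‖) ^ (-(d:ℝ))) volume := by
    apply integrable_one_add_norm; simp [d]
  let M : ℝ := 2 ^ d * (Finset.Iic (d, 2*m)).sup (fun p => SchwartzMap.seminorm ℝ p.1 p.2) g
  have hM : ∀ k ≤ 2*m, ∀ x, ‖iteratedFDeriv ℝ k g x‖ ≤ M * (1 + ‖x‖) ^ (-(d:ℝ)) := by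
    intro k hk x
    have := SchwartzMap.one_add_le_sup_seminorm_apply (𝕜 := ℝ) (m := (d, 2*m)) (k := d) (n := k)
      le_rfl hk g x
    rw [Real.rpow_neg (by positivity), Real.rpow_natCast, ← div_eq_mul_inv, le_div_iff₀ (by positivity),
      mul_comm]
    exact this
  have hM0 : 0 ≤ M := by positivity
  have key : ∀ l : ℂ →L[ℝ] ℝ, ∫ x, u x * l (h x) = 0 := by
    intro l
    have h1 : ∫ y, u y * opL n m A (l ∘ g) y = 0 := by
      refine aux_ext A hu hdec hz (l.contDiff.comp g.smooth') (G := fun x =>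
        ‖l‖ * (M * (1 + ‖x‖) ^ (-(d:ℝ)))) ((hGi.const_mul M).const_mul ‖l‖) (B := ‖l‖ * M)
        (fun x => ?_) (fun k hk x => ?_)
      · have : (1 + ‖x‖) ^ (-(d:ℝ)) ≤ 1 :=
          Real.rpow_le_one_of_one_le_of_nonpos (by linarith [norm_nonneg x]) (by simp)
        gcongr
        exact mul_le_of_le_one_right hM0 this
      · refine (l.norm_iteratedFDeriv_comp_left (g.smooth'.contDiffAt) (natle _)).trans ?_
        gcongr
        exact hM k hk x
    have h2 : ∀ y, opL n m A (l ∘ g) y = (2 * Real.pi) ^ (2*m) * l (h y) := by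
      intro y
      have h3 := aux_symbol A c y
      rw [← hg] at h3
      have h4 : (-(2 * Real.pi * Complex.I) : ℂ) ^ (2*m) =
          ((-1 : ℝ) ^ m * (2 * Real.pi) ^ (2*m) : ℝ) := by
        rw [neg_pow, mul_pow, pow_mul Complex.I, Complex.I_sq]
        push_cast
        simp
        ring
      rw [h4] at h3
      have h5 := congrArg l h3
      rw [map_sum] at h5
      rw [← Complex.real_smul, map_smul] at h5
      unfold opL
      have h6 : ∀ i : Fin (2*m) → Fin n, A i * iteratedFDeriv ℝ (2*m) (l ∘ g) y
          (fun j => stdB n (i j)) =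
          l ((A i : ℂ) * iteratedFDeriv ℝ (2*m) g y (fun j => stdB n (i j))) := by
        intro i
        rw [l.iteratedFDeriv_comp_left (f := (g : En n → ℂ)) g.smooth'.contDiffAt (natle _), ← Complex.real_smul, map_smul]
        rfl
      simp_rw [h6]
      rw [h5, smul_eq_mul, ← mul_assoc, ← mul_assoc, ← pow_add, ← two_mul, pow_mul (-1 : ℝ)]
      simp [h]
    simp_rw [h2] at h1
    have h7 : ∀ y, u y * ((2 * Real.pi) ^ (2*m) * l (h y)) =
      (2 * Real.pi) ^ (2*m) * (u y * l (h y)) := fun y => by ring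
    simp_rw [h7] at h1
    rw [integral_const_mul] at h1
    have : (2 * Real.pi) ^ (2*m) ≠ 0 := by positivity
    exact (mul_eq_zero.1 h1).resolve_left this
  by_cases hi : Integrable (fun x => u x • h x) volume
  · have h8 : ∀ l : ℂ →L[ℝ] ℝ, l (∫ x, u x • h x) = 0 := by
      intro l
      rw [← l.integral_comp_comm hi, ← key l]
      congr 1 with x
      rw [map_smul, smul_eq_mul]
    apply Complex.ext
    · exact h8 Complex.reCLM
    · exact h8 Complex.imCLM
  · exact integral_undef hi

lemma aux_L1_conv {n : ℕ} (f g : SchwartzMap (En n) ℂ) (h : SchwartzMap (En n) ℂ)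
    (hh : ∀ x, h x = f x * g x) :
    ∫ x, ‖(𝓕 h) x‖ ≤ (∫ x, ‖(𝓕⁻ f) x‖) * ∫ x, ‖(𝓕⁻ g) x‖ := by
  have e1 : ∫ x, ‖(𝓕 h) x‖ = ∫ x, ‖(𝓕⁻ h) x‖ := by
    exact (integral_neg_eq_self (fun x : En n => ‖(𝓕 h : SchwartzMap (En n) ℂ) x‖) volume).symm
  rw [e1]
  have e2 : 𝓕⁻ h = SchwartzMap.convolution (ContinuousLinearMap.mul ℂ ℂ) (𝓕⁻ f) (𝓕⁻ g) := by
    have : 𝓕 (SchwartzMap.convolution (ContinuousLinearMap.mul ℂ ℂ) (𝓕⁻ f) (𝓕⁻ g)) = h := by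
      rw [SchwartzMap.fourier_convolution]
      ext x
      simp [hh]
    rw [← this]; simp
  rw [e2]
  have hf := (𝓕⁻ f).integrable (μ := (volume : Measure (En n)))
  have hg := (𝓕⁻ g).integrable (μ := (volume : Measure (En n)))
  have e3 := integral_convolution (μ := (volume : Measure (En n))) (ν := (volume : Measure (En n)))
    (ContinuousLinearMap.mul ℝ ℝ) hf.norm hg.norm
  rw [ContinuousLinearMap.mul_apply'] at e3
  rw [← e3]
  refine integral_mono_of_nonneg (ae_of_all _ fun x => norm_nonneg _)
    (hf.norm.integrable_convolution _ hg.norm) (ae_of_all _ fun x => ?_)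
  dsimp only
  rw [SchwartzMap.convolution_apply]
  unfold MeasureTheory.convolution
  refine (norm_integral_le_integral_norm _).trans (le_of_eq ?_)
  congr 1 with t
  simp

lemma aux_L1_scale {n : ℕ} (f g : SchwartzMap (En n) ℂ) {r : ℝ} (hr : 0 < r)
    (hh : ∀ x, g x = f (r • x)) : ∫ x, ‖(𝓕⁻ g) x‖ = ∫ x, ‖(𝓕⁻ f) x‖ := by
  have e : ∀ x, (𝓕⁻ g) x = (r ^ Module.finrank ℝ (En n))⁻¹ • (𝓕⁻ f) (r⁻¹ • x) := by
    intro x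
    rw [SchwartzMap.fourierInv_coe, SchwartzMap.fourierInv_coe, Real.fourierInv_eq,
      Real.fourierInv_eq, ← Measure.integral_comp_smul_of_nonneg volume _ r (hR := hr.le)]
    congr 1 with v
    rw [hh, inner_smul_left, inner_smul_right]
    simp [hr.ne']
  simp_rw [e, norm_smul]
  rw [integral_const_mul, Measure.integral_comp_inv_smul_of_nonneg volume
    (fun x : En n => ‖(𝓕⁻ f : SchwartzMap (En n) ℂ) x‖) hr.le, Real.norm_of_nonneg (by positivity), smul_eq_mul, ← mul_assoc,
    inv_mul_cancel₀ (by positivity), one_mul]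

lemma symbolQ_contDiff {n m : ℕ} (A : (Fin (2*m) → Fin n) → ℝ) :
    ContDiff ℝ ∞ (symbolQ n m A) := by
  unfold symbolQ
  refine ContDiff.sum fun i _ => contDiff_const.mul ?_
  refine contDiff_prod fun j _ => ?_
  exact (EuclideanSpace.proj (i j) : En n →L[ℝ] ℝ).contDiff

lemma aux_zero {n m : ℕ} (hn : 0 < n) (A : (Fin (2*m) → Fin n) → ℝ) (lam : ℝ) (hlam : 0 < lam)
    (hell : ∀ ξ : En n, lam * ‖ξ‖^(2*m) ≤ symbolQ n m A ξ)
    {u : En n → ℝ} (hu : LocallyIntegrable u volume)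
    (hdec : Tendsto u (cocompact (En n)) (𝓝 0))
    (hz : ∀ ψ : En n → ℝ, ContDiff ℝ ∞ ψ → HasCompactSupport ψ → ∫ y, u y * opL n m A ψ y = 0)
    {b : En n → ℂ} (hb : ContDiff ℝ ∞ b) (hbc : HasCompactSupport b) :
    ∫ x, u x • 𝓕 b x = 0 := by
  obtain ⟨χ, hχ, hχc, hχ1, hχ0, hχle⟩ := aux_cutoff (n := n)
  obtain ⟨Bb, hBb⟩ := hbc.exists_bound_of_continuous hb.continuous
  have hBb0 : 0 ≤ Bb := (norm_nonneg _).trans (hBb 0)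
  let Bs : SchwartzMap (En n) ℂ := hbc.toSchwartzMap hb
  have hχC : ContDiff ℝ ∞ (fun x => (χ x : ℂ)) := Complex.ofRealCLM.contDiff.comp hχ
  have hχCc : HasCompactSupport (fun x => (χ x : ℂ)) :=
    hχc.comp_left (g := fun t : ℝ => (t : ℂ)) (by simp)
  let X : SchwartzMap (En n) ℂ := hχCc.toSchwartzMap hχC
  let J : ℝ := (∫ x, ‖(𝓕⁻ Bs) x‖) * ∫ x, ‖(𝓕⁻ X) x‖
  have hJ : 0 ≤ J := mul_nonneg (integral_nonneg fun _ => norm_nonneg _)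
    (integral_nonneg fun _ => norm_nonneg _)
  have hIS : ∀ s : SchwartzMap (En n) ℂ, Integrable (fun x => u x • s x) volume := fun s =>
    aux_integrable hu hdec s.integrable (B := SchwartzMap.seminorm ℝ 0 0 s)
      (fun x => SchwartzMap.norm_le_seminorm ℝ s x)
  have main : ∀ r : ℝ, 0 < r → ∃ g : En n → ℂ, Integrable g volume ∧
      (∀ x, ‖g x‖ ≤ Bb * ((r ^ n)⁻¹ * ∫ x, χ x)) ∧ ∫ x, ‖g x‖ ≤ J ∧
      ∫ x, u x • 𝓕 b x = ∫ x, u x • g x := by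
    intro r hr
    have hsm : ContDiff ℝ ∞ (fun x : En n => χ (r • x)) := hχ.comp (contDiff_const_smul _)
    have hsmC : ContDiff ℝ ∞ (fun x : En n => (χ (r • x) : ℂ)) := hχC.comp (contDiff_const_smul _)
    have hsmCc : HasCompactSupport (fun x : En n => (χ (r • x) : ℂ)) :=
      hχCc.comp_homeomorph (Homeomorph.smulOfNeZero r hr.ne')
    let Xr : SchwartzMap (En n) ℂ := hsmCc.toSchwartzMap hsmC
    let H : SchwartzMap (En n) ℂ :=
      (hbc.mul_right : HasCompactSupport (fun x => b x * (χ (r • x) : ℂ))).toSchwartzMap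
        (hb.mul hsmC)
    -- the quotient
    let q : En n → ℝ := fun ξ => (1 - χ (r • ξ)) / symbolQ n m A ξ
    have hq : ContDiff ℝ ∞ q := by
      rw [contDiff_iff_contDiffAt]
      intro ξ
      by_cases hξ : ξ = 0
      · have : q =ᶠ[𝓝 ξ] fun _ => 0 := by
          have h1 : ∀ᶠ y in 𝓝 ξ, ‖r • y‖ < 1 := by
            have : Continuous fun y : En n => ‖r • y‖ := by fun_prop
            refine (this.tendsto ξ).eventually (gt_mem_nhds ?_)
            simp [hξ]
          filter_upwards [h1] with y hy
          simp [q, hχ1 _ hy.le]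
        exact contDiffAt_const.congr_of_eventuallyEq this
      · have hpos : 0 < symbolQ n m A ξ :=
          lt_of_lt_of_le (by have := norm_pos_iff.2 hξ; positivity) (hell ξ)
        exact (contDiffAt_const.sub hsm.contDiffAt).div (symbolQ_contDiff A).contDiffAt hpos.ne'
    have hqQ : ∀ ξ, symbolQ n m A ξ * q ξ = 1 - χ (r • ξ) := by
      intro ξ
      by_cases hξ : ξ = 0
      · simp [q, hξ, hχ1]
      · have hpos : 0 < symbolQ n m A ξ :=
          lt_of_lt_of_le (by have := norm_pos_iff.2 hξ; positivity) (hell ξ)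
        simp only [q]
        field_simp
    have hqC : ContDiff ℝ ∞ (fun x => (q x : ℂ)) := Complex.ofRealCLM.contDiff.comp hq
    let c : SchwartzMap (En n) ℂ :=
      (hbc.mul_left : HasCompactSupport (fun x => (q x : ℂ) * b x)).toSchwartzMap (hqC.mul hb)
    have h0 := aux_four A hu hdec hz c
    have h1 : (fun ξ => (symbolQ n m A ξ : ℂ) * c ξ) = ((Bs - H : SchwartzMap (En n) ℂ) : En n → ℂ) := by
      ext ξ
      have : (symbolQ n m A ξ : ℂ) * (q ξ : ℂ) = 1 - (χ (r • ξ) : ℂ) := by exact_mod_cast hqQ ξ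
      change (symbolQ n m A ξ : ℂ) * ((q ξ : ℂ) * b ξ) = b ξ - b ξ * (χ (r • ξ) : ℂ)
      rw [← mul_assoc, this]; ring
    rw [h1, ← SchwartzMap.fourier_coe] at h0
    have h2 : 𝓕 (Bs - H) = 𝓕 Bs - 𝓕 H := map_sub (FourierTransform.fourierCLM ℂ (SchwartzMap (En n) ℂ)) Bs H
    rw [h2] at h0
    have h3 : ∫ x, u x • (𝓕 Bs) x - u x • (𝓕 H) x = 0 := by
      rw [← h0]
      congr 1 with x
      rw [_root_.sub_apply, smul_sub]
    rw [integral_sub (hIS _) (hIS _), sub_eq_zero] at h3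
    refine ⟨(𝓕 H : SchwartzMap (En n) ℂ), (𝓕 H).integrable, fun x => ?_, ?_, ?_⟩
    · rw [SchwartzMap.fourier_coe]
      refine (VectorFourier.norm_fourierIntegral_le_integral_norm _ _ _ _ _).trans ?_
      have h4 : ∫ x, χ (r • x) = (r ^ n)⁻¹ * ∫ x, χ x := by
        rw [Measure.integral_comp_smul_of_nonneg volume _ r (hR := hr.le)]
        simp
      rw [← h4, ← integral_const_mul]
      refine integral_mono_of_nonneg (ae_of_all _ fun x => norm_nonneg _) ?_
        (ae_of_all _ fun v => ?_)
      · refine Integrable.const_mul ?_ _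
        refine hsm.continuous.integrable_of_hasCompactSupport ?_
        exact hχc.comp_homeomorph (Homeomorph.smulOfNeZero r hr.ne')
      · change ‖b v * (χ (r • v) : ℂ)‖ ≤ Bb * χ (r • v)
        rw [norm_mul, Complex.norm_real, Real.norm_of_nonneg (hχ0 _)]
        exact mul_le_mul_of_nonneg_right (hBb v) (hχ0 _)
    · refine (aux_L1_conv Bs Xr H fun x => rfl).trans (le_of_eq ?_)
      rw [aux_L1_scale X Xr hr fun x => rfl]
    · rw [← h3, SchwartzMap.fourier_coe]; rfl
  rw [← norm_le_zero_iff]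
  have hδ : ∀ δ : ℝ, 0 < δ → ‖∫ x, u x • 𝓕 b x‖ ≤ δ * J := by
    intro δ hδ
    obtain ⟨C, hC⟩ := aux_quant hu hdec hδ
    have hlim : Tendsto (fun r : ℝ => C * (Bb * ((r ^ n)⁻¹ * ∫ x, χ x)) + δ * J) atTop
        (𝓝 (C * (Bb * (0 * ∫ x, χ x)) + δ * J)) := by
      refine Tendsto.add_const _ (Tendsto.const_mul _ (Tendsto.const_mul _ (Tendsto.mul_const _ ?_)))
      exact tendsto_inv_atTop_zero.comp (tendsto_pow_atTop hn.ne')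
    rw [zero_mul, mul_zero, mul_zero, zero_add] at hlim
    refine ge_of_tendsto hlim ?_
    filter_upwards [eventually_gt_atTop 0] with r hr
    obtain ⟨g, hg1, hg2, hg3, hg4⟩ := main r hr
    rw [hg4]
    refine (hC g _ hg1 hg2).trans ?_
    gcongr
  have hlim : Tendsto (fun δ : ℝ => δ * J) (𝓝[>] 0) (𝓝 (0 * J)) :=
    (tendsto_id.mul_const J).mono_left nhdsWithin_le_nhds
  rw [zero_mul] at hlim
  refine ge_of_tendsto hlim ?_
  filter_upwards [self_mem_nhdsWithin] with δ hδ' using hδ δ hδ'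

lemma aux_final {n m : ℕ} (hn : 0 < n) (A : (Fin (2*m) → Fin n) → ℝ) (lam : ℝ) (hlam : 0 < lam)
    (hell : ∀ ξ : En n, lam * ‖ξ‖^(2*m) ≤ symbolQ n m A ξ)
    {u : En n → ℝ} (hu : LocallyIntegrable u volume)
    (hdec : Tendsto u (cocompact (En n)) (𝓝 0))
    (hz : ∀ ψ : En n → ℝ, ContDiff ℝ ∞ ψ → HasCompactSupport ψ → ∫ y, u y * opL n m A ψ y = 0)
    {x₀ : En n} (hx₀ : ContinuousAt u x₀) : u x₀ = 0 := by
  obtain ⟨χ, hχ, hχc, hχ1, hχ0, hχle⟩ := aux_cutoff (n := n)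
  let E : En n → ℂ := fun ξ => Complex.exp (((2 * Real.pi * inner ℝ ξ x₀ : ℝ) : ℂ) * Complex.I)
  have hE : ContDiff ℝ ∞ E := by
    refine Complex.contDiff_exp.comp (ContDiff.mul ?_ contDiff_const)
    refine Complex.ofRealCLM.contDiff.comp (contDiff_const.mul ?_)
    exact contDiff_id.inner ℝ contDiff_const
  have hχC : ContDiff ℝ ∞ (fun x => (χ x : ℂ)) := Complex.ofRealCLM.contDiff.comp hχ
  have hχCc : HasCompactSupport (fun x => (χ x : ℂ)) :=
    hχc.comp_left (g := fun t : ℝ => (t : ℂ)) (by simp)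
  let b : En n → ℂ := fun ξ => E ξ * χ ξ
  have hb : ContDiff ℝ ∞ b := hE.mul hχC
  have hbc : HasCompactSupport b := hχCc.mul_left
  let Bs : SchwartzMap (En n) ℂ := hbc.toSchwartzMap hb
  have hBs : ((𝓕 Bs : SchwartzMap (En n) ℂ) : En n → ℂ) = 𝓕 b := SchwartzMap.fourier_coe Bs
  have hne : 𝓕 b x₀ ≠ 0 := by
    have h1 : 𝓕 b x₀ = ((∫ v, χ v : ℝ) : ℂ) := by
      rw [Real.fourier_eq', ← integral_complex_ofReal]
      congr 1 with v
      simp only [b, E]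
      rw [smul_eq_mul, ← mul_assoc, ← Complex.exp_add]
      have : ((-2 * Real.pi * inner ℝ v x₀ : ℝ) : ℂ) * Complex.I
        + ((2 * Real.pi * inner ℝ v x₀ : ℝ) : ℂ) * Complex.I = 0 := by push_cast; ring
      rw [this, Complex.exp_zero, one_mul]
    rw [h1]
    have : 0 < ∫ v, χ v :=
      hχ.continuous.integral_pos_of_hasCompactSupport_nonneg_nonzero hχc hχ0 (x := 0)
        (by rw [hχ1 0 (by simp)]; exact one_ne_zero)
    exact_mod_cast this.ne'
  let F : En n → ℂ := fun x => u x • 𝓕 b x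
  have hF : Integrable F volume := by
    simp only [F, ← hBs]
    exact aux_integrable hu hdec (𝓕 Bs).integrable (B := SchwartzMap.seminorm ℝ 0 0 (𝓕 Bs))
      (fun x => SchwartzMap.norm_le_seminorm ℝ (𝓕 Bs) x)
  have hFF : 𝓕 F = 0 := by
    ext η
    rw [Real.fourier_eq]
    have h1 : ContDiff ℝ ∞ (fun ξ => b (ξ + (-η))) := hb.comp (contDiff_id.add contDiff_const)
    have h2 : HasCompactSupport (fun ξ => b (ξ + (-η))) :=
      hbc.comp_homeomorph (Homeomorph.addRight (-η))
    have h3 := aux_zero hn A lam hlam hell hu hdec hz h1 h2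
    rw [Pi.zero_apply, ← h3]
    congr 1 with x
    have h4 : 𝓕 (fun ξ => b (ξ + (-η))) x = Real.fourierChar (inner ℝ (-η) x) • 𝓕 b x :=
      congrFun (VectorFourier.fourierIntegral_comp_add_right Real.fourierChar volume (innerₗ (En n)) b (-η)) x
    rw [h4, inner_neg_left, real_inner_comm]
    simp only [F]
    rw [smul_comm]
  have hFc : ContinuousAt F x₀ := by
    refine hx₀.smul ?_
    rw [← hBs]
    exact (𝓕 Bs).continuous.continuousAt
  have h5 := hF.fourierInv_fourier_eq (by rw [hFF]; exact integrable_zero _ _ _) hFc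
  rw [hFF] at h5
  have h6 : F x₀ = 0 := by
    rw [← h5, Real.fourierInv_eq]; simp
  exact (smul_eq_zero.1 h6).resolve_right hne

/-- Uniqueness of the homogeneous fundamental solution. -/
theorem stmt1 (n m : ℕ) (hm : 1 ≤ m) (hn : 2*m < n)
    (A : (Fin (2*m) → Fin n) → ℝ) (lam : ℝ) (hlam : 0 < lam)
    (hell : ∀ ξ : En n, lam * ‖ξ‖^(2*m) ≤ symbolQ n m A ξ)
    (K K' : En n → ℝ)
    (hKloc : LocallyIntegrable K volume) (hK'loc : LocallyIntegrable K' volume)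
    (hKcont : ContinuousOn K {(0 : En n)}ᶜ) (hK'cont : ContinuousOn K' {(0 : En n)}ᶜ)
    (hKhom : HomogeneousDeg n ((2*m : ℝ) - n) K)
    (hK'hom : HomogeneousDeg n ((2*m : ℝ) - n) K')
    (hKfund : IsFundamentalSolution n m A K)
    (hK'fund : IsFundamentalSolution n m A K') :
    ∀ x : En n, x ≠ 0 → K x = K' x := by
  have hfun : ∀ L : En n → ℝ, LocallyIntegrable L volume → ∀ ψ : En n → ℝ, ContDiff ℝ ∞ ψ →
      HasCompactSupport ψ → Integrable (fun y => L y * opL n m A ψ y) volume := by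
    intro L hL ψ h1 h2
    exact hL.integrable_smul_right_of_hasCompactSupport (opL_continuous A h1) (opL_compact A h2)
  have hdec1 : ∀ L : En n → ℝ, ContinuousOn L {(0 : En n)}ᶜ →
      HomogeneousDeg n ((2*m : ℝ) - n) L → Tendsto L (cocompact (En n)) (𝓝 0) := by
    intro L hL hh
    obtain ⟨C, hC⟩ := (isCompact_sphere (0 : En n) 1).exists_bound_of_continuousOn
      (hL.mono (fun x hx h0 => by
        rw [Set.mem_singleton_iff] at h0
        simp [h0] at hx))
    have hneg : 0 < (n : ℝ) - 2*m := by
      have : ((2*m : ℕ) : ℝ) < n := by exact_mod_cast hn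
      push_cast at this
      linarith
    have hlim : Tendsto (fun x : En n => ‖x‖ ^ (-((n : ℝ) - 2*m)) * C) (cocompact (En n))
        (𝓝 (0 * C)) :=
      ((tendsto_rpow_neg_atTop hneg).comp (tendsto_norm_cocompact_atTop)).mul_const C
    rw [zero_mul] at hlim
    refine squeeze_zero_norm' ?_ hlim
    have hev : ∀ᶠ x : En n in cocompact (En n), 0 < ‖x‖ :=
      (tendsto_norm_cocompact_atTop).eventually (eventually_gt_atTop 0)
    filter_upwards [hev] with x hx
    have hx0 : x ≠ 0 := norm_pos_iff.1 hx
    have h1 := hh ‖x‖ hx.ne' (‖x‖⁻¹ • x) (smul_ne_zero (inv_ne_zero hx.ne') hx0)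
    rw [smul_smul, mul_inv_cancel₀ hx.ne', one_smul, abs_norm] at h1
    rw [h1, norm_mul, Real.norm_of_nonneg (by positivity), neg_sub]
    refine mul_le_mul_of_nonneg_left (hC _ ?_) (by positivity)
    simp [norm_smul, hx.ne']
  intro x hx
  have hopen : ({(0 : En n)}ᶜ : Set (En n)) ∈ 𝓝 x := isOpen_compl_singleton.mem_nhds hx
  have hdec : Tendsto (fun y => K y - K' y) (cocompact (En n)) (𝓝 0) := by
    simpa using (hdec1 K hKcont hKhom).sub (hdec1 K' hK'cont hK'hom)
  have h := aux_final (u := fun y => K y - K' y) (by omega) A lam hlam hell (hKloc.sub hK'loc) hdec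
    (fun ψ h1 h2 => by
      have h3 := hKfund ψ h1 h2
      have h4 := hK'fund ψ h1 h2
      simp_rw [sub_mul]
      rw [integral_sub (hfun K hKloc ψ h1 h2) (hfun K' hK'loc ψ h1 h2), h3, h4, sub_self])
    (x₀ := x) ((hKcont.continuousAt hopen).sub (hK'cont.continuousAt hopen))
  exact sub_eq_zero.1 h
end
end

section
/- Let n > 2m + 1 with m ≥ 1, let L_n be a uniformly elliptic constant-coefficient operator of order 2m on ℝⁿ with coefficients A_{i₁…i_{2m}}, and let L_{n−1} be the operator on ℝ^{n−1} whose coefficients are A_{i₁…i_{2m}} restricted to indices i_j ∈ {1,…,n−1} (its symbol is Q_{n−1}(ξ′) = Q_n(ξ′,0)). Suppose K : ℝⁿ → ℝ is continuous on ℝⁿ\{0}, satisfies |K(x)| ≤ M|x|^{2m−n} for all x ≠ 0 and some M > 0, and is a fundamental solution of L_n. Define K′(x′) := ∫_ℝ K(x′, t) dt for x′ ∈ ℝ^{n−1}\{0}. Then for every φ ∈ C_c^∞(ℝ^{n−1}) one has ∫_{ℝ^{n−1}} (L_{n−1}φ)(x′) K′(x′) dx′ = φ(0). -/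
open MeasureTheory RealInnerProductSpace

noncomputable section

open Filter Topology

/-- projection to first coordinates -/
def prj (d : ℕ) : En (d+1) →L[ℝ] En d :=
  LinearMap.toContinuousLinearMap
    { toFun := fun y => WithLp.toLp 2 (fun i => y (Fin.castSucc i))
      map_add' := fun x y => by ext i; simp
      map_smul' := fun c y => by ext i; simp }

def lst (d : ℕ) : En (d+1) →L[ℝ] ℝ := EuclideanSpace.proj (Fin.last d)

def scl (d : ℕ) (e : ℝ) : En (d+1) →L[ℝ] En (d+1) :=
  ContinuousLinearMap.id ℝ _ + (e - 1) • (lst d).smulRight (stdB (d+1) (Fin.last d))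

@[simp] lemma prj_apply (d : ℕ) (y : En (d+1)) (i : Fin d) : prj d y i = y (Fin.castSucc i) := rfl

@[simp] lemma lst_apply (d : ℕ) (y : En (d+1)) : lst d y = y (Fin.last d) := rfl

lemma prj_castSucc (d : ℕ) (i : Fin d) : prj d (stdB (d+1) i.castSucc) = stdB d i := by
  ext j; simp [stdB]

lemma prj_last (d : ℕ) : prj d (stdB (d+1) (Fin.last d)) = 0 := by
  ext j; simp [stdB, (Fin.castSucc_lt_last j).ne]

lemma scl_apply (d : ℕ) (e : ℝ) (y : En (d+1)) :
    scl d e y = y + ((e-1) * y (Fin.last d)) • stdB (d+1) (Fin.last d) := by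
  simp [scl, smul_smul]

lemma prj_scl (d : ℕ) (e : ℝ) (y : En (d+1)) : prj d (scl d e y) = prj d y := by
  rw [scl_apply, map_add, map_smul, prj_last]; simp

lemma lst_scl (d : ℕ) (e : ℝ) (y : En (d+1)) : scl d e y (Fin.last d) = e * y (Fin.last d) := by
  rw [scl_apply]; simp [stdB]; ring

lemma scl_cont (d : ℕ) (y : En (d+1)) : Continuous (fun e => scl d e y) := by
  simp only [scl_apply]; fun_prop

lemma scl_castSucc (d : ℕ) (e : ℝ) (i : Fin d) :
    scl d e (stdB (d+1) i.castSucc) = stdB (d+1) i.castSucc := by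
  rw [scl_apply]; simp [stdB, (Fin.castSucc_lt_last i).ne']

lemma scl_last (d : ℕ) (e : ℝ) :
    scl d e (stdB (d+1) (Fin.last d)) = e • stdB (d+1) (Fin.last d) := by
  rw [scl_apply]; simp [stdB, sub_smul]

lemma norm_stdB (n : ℕ) (i : Fin n) : ‖stdB n i‖ = 1 := by simp [stdB]

lemma norm_scl (d : ℕ) (e : ℝ) (h0 : 0 ≤ e) (h1 : e ≤ 1) (i : Fin (d+1)) :
    ‖scl d e (stdB (d+1) i)‖ ≤ 1 := by
  induction i using Fin.lastCases with
  | last => rw [scl_last, norm_smul, norm_stdB, mul_one, Real.norm_eq_abs, abs_of_nonneg h0]; exact h1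
  | cast i => rw [scl_castSucc, norm_stdB]

lemma snocVec_castSucc (d : ℕ) (x : En d) (t : ℝ) (i : Fin d) :
    snocVec d x t i.castSucc = x i := by
  simp [snocVec]

lemma snocVec_last (d : ℕ) (x : En d) (t : ℝ) : snocVec d x t (Fin.last d) = t := by
  simp [snocVec]

lemma prj_snocVec (d : ℕ) (x : En d) (t : ℝ) : prj d (snocVec d x t) = x := by
  ext i; simp [snocVec_castSucc]

lemma snocVec_prj (d : ℕ) (y : En (d+1)) : snocVec d (prj d y) (y (Fin.last d)) = y := by
  ext i
  induction i using Fin.lastCases with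
  | last => rw [snocVec_last]
  | cast i => rw [snocVec_castSucc]; rfl

lemma snocVec_cont (d : ℕ) : Continuous (fun p : En d × ℝ => snocVec d p.1 p.2) := by
  unfold snocVec
  refine (EuclideanSpace.equiv (Fin (d+1)) ℝ).symm.continuous.comp ?_
  refine continuous_pi fun i => ?_
  induction i using Fin.lastCases with
  | last => simpa using continuous_snd
  | cast i => simp; fun_prop

lemma norm_sq_snocVec (d : ℕ) (x : En d) (t : ℝ) : ‖snocVec d x t‖^2 = ‖x‖^2 + t^2 := by
  rw [EuclideanSpace.norm_sq_eq, EuclideanSpace.norm_sq_eq, Fin.sum_univ_castSucc]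
  simp [snocVec_castSucc, snocVec_last]

/-- measurable equivalence -/
def snocE (d : ℕ) : En d × ℝ ≃ᵐ En (d+1) where
  toFun p := snocVec d p.1 p.2
  invFun y := (prj d y, y (Fin.last d))
  left_inv p := by simp [prj_snocVec, snocVec_last]
  right_inv y := snocVec_prj d y
  measurable_toFun := (snocVec_cont d).measurable
  measurable_invFun := by
    have : Continuous fun y : En (d+1) => (prj d y, lst d y) := by fun_prop
    exact this.measurable

lemma snocE_mp (d : ℕ) : MeasurePreserving (snocE d) volume volume := by
  have h1 := (volume_preserving_piFinSuccAbove (fun _ : Fin (d+1) => ℝ) (Fin.last d)).symm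
  have h2 := PiLp.volume_preserving_toLp (Fin (d+1))
  have h3 : MeasurePreserving (Prod.map (id : ℝ → ℝ) (WithLp.ofLp : En d → (Fin d → ℝ))) volume volume :=
    (MeasurePreserving.id volume).prod (PiLp.volume_preserving_ofLp (Fin d))
  have h4 : MeasurePreserving (Prod.swap : En d × ℝ → ℝ × En d) volume volume :=
    Measure.measurePreserving_swap
  have h := h2.comp (h1.comp (h3.comp h4))
  suffices heq : (snocE d : En d × ℝ → En (d+1)) = (WithLp.toLp 2 ∘
      ⇑(MeasurableEquiv.piFinSuccAbove (fun _ : Fin (d+1) => ℝ) (Fin.last d)).symm ∘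
        Prod.map id WithLp.ofLp ∘ Prod.swap) by
    rw [heq]; exact h
  funext p
  ext i
  induction i using Fin.lastCases with
  | last => 
    change snocVec d p.1 p.2 _ = Fin.insertNth (α := fun _ => ℝ) (Fin.last d) p.2 (fun i => p.1 i) _
    rw [snocVec_last]; simp
  | cast i =>
    change snocVec d p.1 p.2 _ = Fin.insertNth (α := fun _ => ℝ) (Fin.last d) p.2 (fun i => p.1 i) _
    rw [snocVec_castSucc, Fin.insertNth_last']; simp

lemma nat_le_infty (k : ℕ) : (k : WithTop ℕ∞) ≤ ((⊤ : ℕ∞) : WithTop ℕ∞) := by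
  exact_mod_cast (le_top : (k : ℕ∞) ≤ ⊤)

lemma opL_comp_prj (d m : ℕ) (A : (Fin (2*m) → Fin (d+1)) → ℝ) (φ : En d → ℝ)
    (hφ : ContDiff ℝ (⊤ : ℕ∞) φ) (y : En (d+1)) :
    opL (d+1) m A (φ ∘ prj d) y =
      opL d m (fun i => A (fun j => Fin.castSucc (i j))) φ (prj d y) := by
  unfold opL
  congr 1
  rw [ContinuousLinearMap.iteratedFDeriv_comp_right _ hφ _ (nat_le_infty _)]
  simp only [ContinuousMultilinearMap.compContinuousLinearMap_apply]
  symm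
  refine Fintype.sum_of_injective (fun i j => Fin.castSucc (i j)) ?_ _ _ ?_ ?_
  · intro a b h
    funext j
    exact Fin.castSucc_injective d (congrFun h j)
  · intro i hi
    have : ∃ j, i j = Fin.last d := by
      by_contra hc
      push Not at hc
      exact hi ⟨fun j => (i j).castPred (hc j), by funext j; simp⟩
    obtain ⟨j, hj⟩ := this
    rw [ContinuousMultilinearMap.map_coord_zero _ j (by rw [hj, prj_last]), mul_zero]
  · intro i
    simp only [prj_castSucc]

lemma int_norm_rpow {E : Type*} [NormedAddCommGroup E] [NormedSpace ℝ E]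
    [FiniteDimensional ℝ E] [MeasurableSpace E] [BorelSpace E] [Nontrivial E]
    (μ : Measure E) [μ.IsAddHaarMeasure] (d : ℕ) (hE : Module.finrank ℝ E = d)
    (s R : ℝ) (hs : s < d) :
    Integrable (fun x : E => (Set.Iic R).indicator (fun r : ℝ => r ^ (-s)) ‖x‖) μ := by
  have hd : 1 ≤ d := by rw [← hE]; exact Module.finrank_pos
  rw [integrable_fun_norm_addHaar μ (f := (Set.Iic R).indicator (fun r : ℝ => r ^ (-s)))]
  have h : IntegrableOn (fun r : ℝ => r ^ ((d:ℝ) - 1 - s)) (Set.Ioc 0 R) := by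
    rcases le_total 0 R with h0 | h0
    · rw [← intervalIntegrable_iff_integrableOn_Ioc_of_le h0]
      exact intervalIntegral.intervalIntegrable_rpow' (by linarith)
    · rw [Set.Ioc_eq_empty (not_lt.2 h0)]; simp
  have h2 : IntegrableOn ((Set.Iic R).indicator fun r : ℝ => r ^ ((d:ℝ) - 1 - s)) (Set.Ioi 0) := by
    rw [IntegrableOn, integrable_indicator_iff measurableSet_Iic, IntegrableOn,
      Measure.restrict_restrict measurableSet_Iic]
    rwa [Set.Iic_inter_Ioi]
  refine h2.congr_fun ?_ measurableSet_Ioi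
  intro r hr
  have hr : 0 < r := hr
  by_cases hR : r ∈ Set.Iic R
  · simp only [Set.indicator_of_mem hR, hE, smul_eq_mul]
    rw [← Real.rpow_natCast, ← Real.rpow_add hr]
    congr 1
    push_cast [hd]; ring
  · simp [Set.indicator_of_notMem hR]

lemma kmeas (n : ℕ) (hn : 1 ≤ n) (K : En n → ℝ) (hKcont : ContinuousOn K {(0 : En n)}ᶜ) :
    AEStronglyMeasurable K volume := by
  have : Nonempty (Fin n) := ⟨⟨0, hn⟩⟩
  have h := hKcont.aestronglyMeasurable (μ := volume) (measurableSet_singleton _).compl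
  rwa [restrict_compl_singleton] at h

lemma pt_bound (p a t y : ℝ) (hp : 2 ≤ p) (ha : 0 < a) (ht : t ≠ 0) (hay : a ≤ y) (hty : |t| ≤ y) :
    y ^ (-p) ≤ a ^ (-(p - 1/2)) * (Set.Iic 1).indicator (fun r : ℝ => r ^ (-(1/2 : ℝ))) |t|
      + 2 * (1 + t^2)⁻¹ := by
  have ht' : 0 < |t| := abs_pos.2 ht
  have hy : 0 < y := ha.trans_le hay
  by_cases h1 : |t| ∈ Set.Iic (1:ℝ)
  · rw [Set.indicator_of_mem h1]
    have e1 : y ^ (-p) = y ^ (-(p-1/2)) * y ^ (-(1/2 : ℝ)) := by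
      rw [← Real.rpow_add hy]; congr 1; ring
    have e2 : y ^ (-(p-1/2)) ≤ a ^ (-(p-1/2)) :=
      Real.rpow_le_rpow_of_nonpos ha hay (by linarith)
    have e3 : y ^ (-(1/2 : ℝ)) ≤ |t| ^ (-(1/2 : ℝ)) :=
      Real.rpow_le_rpow_of_nonpos ht' hty (by norm_num)
    have e4 : 0 ≤ 2 * (1 + t^2)⁻¹ := by positivity
    rw [e1]
    have := mul_le_mul e2 e3 (by positivity) (by positivity)
    linarith
  · rw [Set.indicator_of_notMem h1, mul_zero, zero_add]
    have h1 : 1 < |t| := by simpa using h1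
    have e2 : y ^ (-p) ≤ |t| ^ (-p) := Real.rpow_le_rpow_of_nonpos ht' hty (by linarith)
    have e3 : |t| ^ (-p) ≤ |t| ^ (-2 : ℝ) := Real.rpow_le_rpow_of_exponent_le h1.le (by linarith)
    have e4 : |t| ^ (-2 : ℝ) = (t^2)⁻¹ := by
      rw [Real.rpow_neg ht'.le]; norm_num
    have h2 : 1 < t^2 := by rw [← sq_abs]; nlinarith
    have e5 : (t^2)⁻¹ ≤ 2 * (1 + t^2)⁻¹ := by
      rw [← div_eq_mul_inv, inv_eq_one_div, div_le_div_iff₀ (by positivity) (by positivity)]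
      linarith
    linarith

lemma kint (d m : ℕ) (hm : 1 ≤ m) (hd : 2*m + 1 < d + 1) (K : En (d+1) → ℝ)
    (hKcont : ContinuousOn K {(0 : En (d+1))}ᶜ) (M : ℝ) (hM : 0 < M)
    (hKbound : ∀ x : En (d+1), x ≠ 0 → |K x| ≤ M * ‖x‖ ^ ((2*m : ℝ) - (d+1))) (R : ℝ) :
    Integrable (fun p : En d × ℝ =>
      (Metric.closedBall (0 : En d) R).indicator (fun _ => (1:ℝ)) p.1 * K (snocE d p)) volume := by
  have : Nonempty (Fin d) := ⟨⟨0, by omega⟩⟩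
  have : Nontrivial (En d) := inferInstance
  have hm' : (1:ℝ) ≤ m := by exact_mod_cast hm
  have hd' : (2:ℝ) * m + 1 ≤ d := by exact_mod_cast (by omega : 2 * m + 1 ≤ d)
  set p : ℝ := (d + 1) - 2 * m with hp
  have f1 := int_norm_rpow (volume : Measure (En d)) d (by simp) (p - 1/2) R (by linarith)
  have f2 := int_norm_rpow (volume : Measure (En d)) d (by simp) 0 R (by linarith)
  have g1 := int_norm_rpow (volume : Measure ℝ) 1 (by simp) (1/2) 1 (by norm_num)
  have g2 := integrable_inv_one_add_sq.const_mul 2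
  have hb := ((f1.mul_prod g1).add (f2.mul_prod g2)).const_mul M
  refine Integrable.mono' hb ?_ ?_
  · refine AEStronglyMeasurable.mul ?_ ?_
    · have : Measurable ((Metric.closedBall (0 : En d) R).indicator (fun _ => (1:ℝ))) :=
        measurable_const.indicator Metric.isClosed_closedBall.measurableSet
      exact (this.comp measurable_fst).aestronglyMeasurable
    · exact (kmeas (d+1) (by omega) K hKcont).comp_measurePreserving (snocE_mp d)
  · have a1 : ∀ᵐ q : En d × ℝ, q.1 ≠ 0 :=
      Measure.quasiMeasurePreserving_fst.ae (Measure.ae_ne volume (0 : En d))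
    have a2 : ∀ᵐ q : En d × ℝ, q.2 ≠ 0 :=
      Measure.quasiMeasurePreserving_snd.ae (Measure.ae_ne volume (0 : ℝ))
    filter_upwards [a1, a2] with q h1 h2
    have hx : 0 < ‖q.1‖ := norm_pos_iff.2 h1
    have hs : ‖snocE d q‖^2 = ‖q.1‖^2 + q.2^2 := norm_sq_snocVec d q.1 q.2
    have l1 : ‖q.1‖ ≤ ‖snocE d q‖ := by
      apply le_of_sq_le_sq _ (norm_nonneg _); nlinarith [sq_nonneg q.2]
    have l2 : |q.2| ≤ ‖snocE d q‖ := by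
      apply le_of_sq_le_sq _ (norm_nonneg _); rw [sq_abs]; nlinarith [sq_nonneg ‖q.1‖]
    by_cases hR : q.1 ∈ Metric.closedBall (0 : En d) R
    · have hR' : ‖q.1‖ ∈ Set.Iic R := by simpa using hR
      have hne : snocE d q ≠ 0 := norm_pos_iff.1 (hx.trans_le l1)
      have hk := hKbound _ hne
      have hpt := pt_bound p ‖q.1‖ q.2 ‖snocE d q‖ (by linarith) hx h2 l1 l2
      simp only [Set.indicator_of_mem hR, Set.indicator_of_mem hR', one_mul, neg_zero,
        Real.rpow_zero, Real.norm_eq_abs, Pi.add_apply]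
      refine hk.trans ?_
      have : (2*m : ℝ) - (d+1) = -p := by rw [hp]; ring
      rw [this]
      gcongr
    · have hR' : ‖q.1‖ ∉ Set.Iic R := by simpa using hR
      simp [Set.indicator_of_notMem hR, Set.indicator_of_notMem hR']

lemma opL_scl (d m : ℕ) (A : (Fin (2*m) → Fin (d+1)) → ℝ) (ψ : En (d+1) → ℝ)
    (hψ : ContDiff ℝ (⊤ : ℕ∞) ψ) (e : ℝ) (y : En (d+1)) :
    opL (d+1) m A (ψ ∘ scl d e) y = (-1 : ℝ)^m * ∑ i : Fin (2*m) → Fin (d+1),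
      A i * iteratedFDeriv ℝ (2*m) ψ (scl d e y) (fun j => scl d e (stdB (d+1) (i j))) := by
  unfold opL
  rw [ContinuousLinearMap.iteratedFDeriv_comp_right _ hψ _ (nat_le_infty _)]
  simp only [ContinuousMultilinearMap.compContinuousLinearMap_apply]

lemma opL_scl_tendsto (d m : ℕ) (A : (Fin (2*m) → Fin (d+1)) → ℝ) (ψ : En (d+1) → ℝ)
    (hψ : ContDiff ℝ (⊤ : ℕ∞) ψ) (y : En (d+1)) :
    Continuous (fun e => opL (d+1) m A (ψ ∘ scl d e) y) := by
  simp only [opL_scl d m A ψ hψ]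
  refine continuous_const.mul (continuous_finsetSum _ fun i _ => continuous_const.mul ?_)
  have h1 : Continuous fun e => iteratedFDeriv ℝ (2*m) ψ (scl d e y) :=
    (hψ.continuous_iteratedFDeriv (nat_le_infty _)).comp (scl_cont d y)
  have h2 : Continuous fun e => (fun j => scl d e (stdB (d+1) (i j))) :=
    continuous_pi fun j => scl_cont d _
  exact h1.eval h2

lemma opL_cont (n m : ℕ) (A : (Fin (2*m) → Fin n) → ℝ) (ψ : En n → ℝ)
    (hψ : ContDiff ℝ (⊤ : ℕ∞) ψ) : Continuous (opL n m A ψ) := by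
  unfold opL
  refine continuous_const.mul (continuous_finsetSum _ fun i _ => continuous_const.mul ?_)
  exact (hψ.continuous_iteratedFDeriv (nat_le_infty _)).eval continuous_const

lemma opL_scl_bound (d m : ℕ) (A : (Fin (2*m) → Fin (d+1)) → ℝ) (ψ : En (d+1) → ℝ)
    (hψ : ContDiff ℝ (⊤ : ℕ∞) ψ) (hc : HasCompactSupport ψ) (R : ℝ)
    (hR : ∀ y, ψ y ≠ 0 → prj d y ∈ Metric.closedBall (0 : En d) R) :
    ∃ C, ∀ e, 0 ≤ e → e ≤ 1 → ∀ y, |opL (d+1) m A (ψ ∘ scl d e) y| ≤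
      C * (Metric.closedBall (0 : En d) R).indicator (fun _ => (1:ℝ)) (prj d y) := by
  obtain ⟨C, hC⟩ := (hc.iteratedFDeriv (𝕜 := ℝ) (2*m)).exists_bound_of_continuous
    (hψ.continuous_iteratedFDeriv (nat_le_infty _))
  refine ⟨∑ i, |A i| * C, fun e h0 h1 y => ?_⟩
  rw [opL_scl d m A ψ hψ]
  by_cases hy : prj d y ∈ Metric.closedBall (0 : En d) R
  · rw [Set.indicator_of_mem hy, mul_one, abs_mul, abs_pow, abs_neg, abs_one, one_pow, one_mul]
    refine (Finset.abs_sum_le_sum_abs _ _).trans (Finset.sum_le_sum fun i _ => ?_)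
    rw [abs_mul]
    gcongr
    rw [← Real.norm_eq_abs]
    refine (ContinuousMultilinearMap.le_opNorm _ _).trans ?_
    refine (mul_le_of_le_one_right (norm_nonneg _) ?_).trans (hC _)
    exact Finset.prod_le_one (fun _ _ => norm_nonneg _) fun j _ => norm_scl d e h0 h1 _
  · have hts : tsupport ψ ⊆ prj d ⁻¹' Metric.closedBall (0 : En d) R :=
      closure_minimal hR (Metric.isClosed_closedBall.preimage (prj d).continuous)
    have hz : iteratedFDeriv ℝ (2*m) ψ (scl d e y) = 0 := by
      by_contra hne
      have := hts (support_iteratedFDeriv_subset (𝕜 := ℝ) (2*m) hne)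
      rw [Set.mem_preimage, prj_scl] at this
      exact hy this
    rw [hz]; simp [Set.indicator_of_notMem hy]

theorem stmt3 (d m : ℕ) (hm : 1 ≤ m) (hd : 2*m + 1 < d + 1)
    (A : (Fin (2*m) → Fin (d+1)) → ℝ) (lam : ℝ) (hlam : 0 < lam)
    (hell : ∀ ξ : En (d+1), lam * ‖ξ‖^(2*m) ≤ symbolQ (d+1) m A ξ)
    (K : En (d+1) → ℝ)
    (hKcont : ContinuousOn K {(0 : En (d+1))}ᶜ)
    (M : ℝ) (hM : 0 < M)
    (hKbound : ∀ x : En (d+1), x ≠ 0 → |K x| ≤ M * ‖x‖ ^ ((2*m : ℝ) - (d+1)))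
    (hKfund : IsFundamentalSolution (d+1) m A K) :
    ∀ φ : En d → ℝ, ContDiff ℝ (⊤ : ℕ∞) φ → HasCompactSupport φ →
      ∫ x' : En d,
          opL d m (fun i => A (fun j => Fin.castSucc (i j))) φ x' *
            (∫ t : ℝ, K (snocVec d x' t)) = φ 0 := by
  intro φ hφ hφc
  let η : ContDiffBump (0 : ℝ) := ⟨1, 2, one_pos, one_lt_two⟩
  have hη0 : η 0 = 1 := η.one_of_mem_closedBall (by simp [η])
  let ψ : En (d+1) → ℝ := fun y => φ (prj d y) * η (lst d y)
  have hψ : ContDiff ℝ (⊤ : ℕ∞) ψ :=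
    (hφ.comp (prj d).contDiff).mul (η.contDiff.comp (lst d).contDiff)
  obtain ⟨R, hR⟩ := hφc.isCompact.isBounded.subset_closedBall (0 : En d)
  have hψe : ∀ e, 0 < e → HasCompactSupport (ψ ∘ scl d e) := by
    intro e he
    refine HasCompactSupport.intro (((isCompact_closedBall (0 : En d) R).prod
      (isCompact_closedBall (0 : ℝ) (2/e))).image (snocVec_cont d)) ?_
    intro y hy
    by_contra hne
    apply hy
    have hne : φ (prj d (scl d e y)) * η (scl d e y (Fin.last d)) ≠ 0 := hne
    rw [prj_scl, lst_scl] at hne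
    refine ⟨(prj d y, y (Fin.last d)), ⟨hR (subset_tsupport _ (left_ne_zero_of_mul hne)), ?_⟩,
      snocVec_prj d y⟩
    have h2 : e * y (Fin.last d) ∈ Function.support η := right_ne_zero_of_mul hne
    rw [η.support_eq] at h2
    have h2 : |e * y (Fin.last d)| < 2 := by simpa [η] using h2
    rw [abs_mul, abs_of_pos he] at h2
    simp only [mem_closedBall_zero_iff, Real.norm_eq_abs]
    rw [le_div_iff₀ he]; linarith
  have hscl1 : ψ ∘ scl d 1 = ψ := by
    funext y; simp [scl_apply]
  have hψc : HasCompactSupport ψ := by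
    have := hψe 1 one_pos
    rwa [hscl1] at this
  have hscl0 : ψ ∘ scl d 0 = φ ∘ prj d := by
    funext y
    change φ (prj d (scl d 0 y)) * η (scl d 0 y (Fin.last d)) = _
    rw [prj_scl, lst_scl, zero_mul, hη0, mul_one]; rfl
  obtain ⟨C, hC⟩ := opL_scl_bound d m A ψ hψ hψc R
    (fun y hy => hR (subset_tsupport _ (left_ne_zero_of_mul hy)))
  have hint := kint d m hm hd K hKcont M hM hKbound R
  have hKm := kmeas (d+1) (by omega) K hKcont
  have hmp := snocE_mp d
  have hKm' : AEStronglyMeasurable (fun p => K (snocE d p)) (volume : Measure (En d × ℝ)) :=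
    hKm.comp_measurePreserving hmp
  have hFm : ∀ e, AEStronglyMeasurable
      (fun p => K (snocE d p) * opL (d+1) m A (ψ ∘ scl d e) (snocE d p))
      (volume : Measure (En d × ℝ)) := fun e =>
    hKm'.mul ((opL_cont (d+1) m A _ (hψ.comp (scl d e).contDiff)).comp
      (snocVec_cont d)).aestronglyMeasurable
  have hFb : ∀ e, 0 ≤ e → e ≤ 1 → ∀ p : En d × ℝ,
      ‖K (snocE d p) * opL (d+1) m A (ψ ∘ scl d e) (snocE d p)‖ ≤
      C * ‖(Metric.closedBall (0 : En d) R).indicator (fun _ => (1:ℝ)) p.1 * K (snocE d p)‖ := by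
    intro e h0 h1 p
    have h := hC e h0 h1 (snocE d p)
    have hp : prj d (snocE d p) = p.1 := prj_snocVec d p.1 p.2
    rw [hp] at h
    have hi : 0 ≤ (Metric.closedBall (0 : En d) R).indicator (fun _ => (1:ℝ)) p.1 :=
      Set.indicator_nonneg (fun _ _ => zero_le_one) _
    rw [norm_mul, norm_mul, Real.norm_of_nonneg hi, ← mul_assoc, mul_comm]
    exact mul_le_mul_of_nonneg_right h (norm_nonneg _)
  have hbi := hint.norm.const_mul C
  have hev : ∀ᶠ e : ℝ in 𝓝[>] 0, 0 < e ∧ e ≤ 1 := by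
    filter_upwards [Ioc_mem_nhdsGT (zero_lt_one : (0:ℝ) < 1)] with e he using he
  have hlim := tendsto_integral_filter_of_dominated_convergence (μ := (volume : Measure (En d × ℝ)))
    (l := 𝓝[>] (0:ℝ))
    (F := fun e p => K (snocE d p) * opL (d+1) m A (ψ ∘ scl d e) (snocE d p))
    (f := fun p => K (snocE d p) * opL (d+1) m A (ψ ∘ scl d 0) (snocE d p)) _
    (Eventually.of_forall hFm)
    (hev.mono fun e he => Eventually.of_forall (hFb e he.1.le he.2)) hbi
    (Eventually.of_forall fun p => (((opL_scl_tendsto d m A ψ hψ (snocE d p)).tendsto 0).mono_left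
      nhdsWithin_le_nhds).const_mul _)
  have hconst : ∀ᶠ e : ℝ in 𝓝[>] 0,
      ∫ p, K (snocE d p) * opL (d+1) m A (ψ ∘ scl d e) (snocE d p) = φ 0 := by
    filter_upwards [hev] with e he
    rw [hmp.integral_comp' (fun y => K y * opL (d+1) m A (ψ ∘ scl d e) y),
      hKfund _ (hψ.comp (scl d e).contDiff) (hψe e he.1)]
    simp [ψ, hη0]
  have hfin := tendsto_nhds_unique (tendsto_const_nhds.congr' (hconst.mono fun _ h => h.symm)) hlim
  have hi0 : Integrable (fun p => K (snocE d p) * opL (d+1) m A (ψ ∘ scl d 0) (snocE d p))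
      (volume : Measure (En d × ℝ)) :=
    hbi.mono' (hFm 0) (Eventually.of_forall (hFb 0 le_rfl zero_le_one))
  rw [hfin]
  rw [Measure.volume_eq_prod] at hi0 ⊢
  rw [integral_prod _ hi0]
  refine integral_congr_ae (Eventually.of_forall fun x => ?_)
  simp only
  rw [← integral_const_mul]
  refine integral_congr_ae (Eventually.of_forall fun t => ?_)
  simp only
  rw [hscl0, opL_comp_prj d m A φ hφ, mul_comm]
  have hp : prj d (snocE d (x, t)) = x := prj_snocVec d x t
  rw [hp]; rfl
end
end
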